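/- arXiv:2206.12093 — 2 statements merged into one kernel-verified Lean document; each statement's English description precedes it below -/
import Mathlib

section
/- Let q ≥ 2 and let n, m be positive integers. Let A and G be n×m matrices over ℤ_q, let R₁, R₂ be m×m integer matrices, and let b, b′ ∈ {0,1} with b ≠ b′. Suppose A·R̄₁ + (b : ℤ_q) • G = A·R̄₂ + (b′ : ℤ_q) • G. Then for every integer vector e ∈ ℤ^m with G·ē = 0 over ℤ_q, it holds that A · ( (R₁ − R₂)·e mod q ) = 0 over ℤ_q, where (R₁ − R₂)·e is computed over ℤ and then reduced modulo q. -/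
/-- Algebraic core of Claim 4: colliding homomorphically evaluated matrices with
different PRF bits yield an SIS solution from any kernel vector of the gadget matrix. -/
theorem claim4_core (q n m : ℕ) (hq : 2 ≤ q) (hn : 0 < n) (hm : 0 < m)
    (A G : Matrix (Fin n) (Fin m) (ZMod q))
    (R1 R2 : Matrix (Fin m) (Fin m) ℤ)
    (b b' : ℤ) (hb : b = 0 ∨ b = 1) (hb' : b' = 0 ∨ b' = 1) (hne : b ≠ b')
    (h : A * R1.map (Int.cast : ℤ → ZMod q) + (b : ZMod q) • G
        = A * R2.map (Int.cast : ℤ → ZMod q) + (b' : ZMod q) • G)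
    (e : Fin m → ℤ) (he : G.mulVec (fun j => ((e j : ZMod q))) = 0) :
    A.mulVec (fun j => ((((R1 - R2).mulVec e) j : ℤ) : ZMod q)) = 0 := by
  have hcast (R : Matrix (Fin m) (Fin m) ℤ) :
      (fun j => ((R.mulVec e j : ℤ) : ZMod q))
        = (R.map (Int.cast : ℤ → ZMod q)).mulVec (fun j => (e j : ZMod q)) :=
    funext fun j => RingHom.map_mulVec (Int.castRingHom (ZMod q)) R e j
  have key := congrArg (fun M => M.mulVec (fun j => (e j : ZMod q))) h
  simp only [Matrix.add_mulVec, Matrix.smul_mulVec, he, smul_zero, add_zero,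
    ← Matrix.mulVec_mulVec] at key
  rw [hcast, Matrix.map_sub Int.cast Int.cast_sub, Matrix.sub_mulVec, Matrix.mulVec_sub, key,
    sub_self]
end

section
/- Let q ≥ 2 and let n, m, N be positive integers, let B ≥ 0 and s ≥ 0 be real numbers. For each i ∈ {1,…,N}, let A⁽ⁱ⁾ be an n×m matrix over ℤ_q, let R⁽ⁱ⁾ be an m×m integer matrix each of whose columns has Euclidean norm at most B, and let x₁⁽ⁱ⁾, x₂⁽ⁱ⁾ ∈ ℤ^m. Suppose (i) the concatenated vector x = (x₁⁽¹⁾, x₂⁽¹⁾, …, x₁⁽ᴺ⁾, x₂⁽ᴺ⁾) ∈ ℤ^{2Nm} satisfies ‖x‖ ≤ s, and (ii) Σᵢ₌₁^N ( A⁽ⁱ⁾·x̄₁⁽ⁱ⁾ + (A⁽ⁱ⁾·R̄⁽ⁱ⁾)·x̄₂⁽ⁱ⁾ ) = 0 over ℤ_q. Then the integer vector x̂ ∈ ℤ^{Nm} with blocks x̂⁽ⁱ⁾ = x₁⁽ⁱ⁾ + R⁽ⁱ⁾·x₂⁽ⁱ⁾ satisfies [A⁽¹⁾ | ⋯ | A⁽ᴺ⁾]·x̂̄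 = 0 over ℤ_q and ‖x̂‖ ≤ √2·(1 + B√m)·s. -/
/-- Euclidean (ℓ2) norm of an integer vector (norm of its image in ℝ). -/
noncomputable def l2norm {ι : Type*} [Fintype ι] (v : ι → ℤ) : ℝ :=
  Real.sqrt (∑ i, ((v i : ℝ)) ^ 2)

theorem l2norm_le_of_sum_sq_le {ι : Type*} [Fintype ι] {v : ι → ℤ} {c : ℝ} (hc : 0 ≤ c)
    (h : ∑ i, (v i : ℝ) ^ 2 ≤ c ^ 2) : l2norm v ≤ c :=
  Real.sqrt_le_iff.mpr ⟨hc, h⟩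

theorem sum_sq_le_of_l2norm_le {ι : Type*} [Fintype ι] {v : ι → ℤ} {c : ℝ}
    (h : l2norm v ≤ c) : ∑ i, (v i : ℝ) ^ 2 ≤ c ^ 2 :=
  (Real.sqrt_le_iff.mp h).2

/-- A matrix whose columns have norm at most `B` has squared Frobenius norm at most
`card κ * B ^ 2`, which bounds its action on vectors. -/
theorem sum_sq_mulVec_le {ι κ : Type*} [Fintype ι] [Fintype κ] (M : Matrix ι κ ℤ) {B : ℝ}
    (hM : ∀ j, l2norm (fun r => M r j) ≤ B) (v : κ → ℤ) :
    ∑ r, (M.mulVec v r : ℝ) ^ 2 ≤ Fintype.card κ * B ^ 2 * ∑ j, (v j : ℝ) ^ 2 := by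
  calc ∑ r, (M.mulVec v r : ℝ) ^ 2
      ≤ ∑ r, (∑ j, (M r j : ℝ) ^ 2) * ∑ j, (v j : ℝ) ^ 2 := by
        refine Finset.sum_le_sum fun r _ => ?_
        simp only [Matrix.mulVec, dotProduct, Int.cast_sum, Int.cast_mul]
        exact Finset.sum_mul_sq_le_sq_mul_sq _ _ _
    _ = (∑ j, ∑ r, (M r j : ℝ) ^ 2) * ∑ j, (v j : ℝ) ^ 2 := by
        rw [← Finset.sum_mul, Finset.sum_comm]
    _ ≤ (∑ _j : κ, B ^ 2) * ∑ j, (v j : ℝ) ^ 2 := by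
        gcongr with j
        exact sum_sq_le_of_l2norm_le (hM j)
    _ = Fintype.card κ * B ^ 2 * ∑ j, (v j : ℝ) ^ 2 := by simp

/-- The complete deterministic content of the forgery-exploitation step in the
unforgeability proof: a valid forged ring signature of norm at most s yields a
short solution of the homogeneous SIS equation for the challenge matrix. -/
theorem forgery_exploitation (q n m N : ℕ) (hq : 2 ≤ q) (hn : 0 < n) (hm : 0 < m) (hN : 0 < N)
    (B s : ℝ) (hB : 0 ≤ B) (hs : 0 ≤ s)
    (A : Fin N → Matrix (Fin n) (Fin m) (ZMod q))
    (R : Fin N → Matrix (Fin m) (Fin m) ℤ)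
    (hcols : ∀ i j, l2norm (fun r => R i r j) ≤ B)
    (x1 x2 : Fin N → Fin m → ℤ)
    (x : Fin N × (Fin m ⊕ Fin m) → ℤ)
    (hx : ∀ i j, x (i, Sum.inl j) = x1 i j ∧ x (i, Sum.inr j) = x2 i j)
    (hnorm : l2norm x ≤ s)
    (hring : ∑ i, ((A i).mulVec (fun j => ((x1 i j : ZMod q)))
          + ((A i) * (R i).map (Int.cast : ℤ → ZMod q)).mulVec
              (fun j => ((x2 i j : ZMod q)))) = 0)
    (xhat : Fin N × Fin m → ℤ)
    (hxhat : ∀ i j, xhat (i, j) = (x1 i + (R i).mulVec (x2 i)) j)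
    (Afull : Matrix (Fin n) (Fin N × Fin m) (ZMod q))
    (hA : ∀ r i j, Afull r (i, j) = A i r j) :
    Afull.mulVec (fun p => ((xhat p : ZMod q))) = 0
      ∧ l2norm xhat ≤ Real.sqrt 2 * (1 + B * Real.sqrt m) * s := by
  refine ⟨?_, ?_⟩
  · have hcast : ∀ i, (fun j => ((xhat (i, j) : ZMod q))) =
        (fun j => ((x1 i j : ZMod q))) +
          ((R i).map (Int.cast : ℤ → ZMod q)).mulVec (fun j => ((x2 i j : ZMod q))) := by
      intro i
      ext j
      simp [hxhat, Matrix.mulVec, dotProduct]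
    rw [← hring]
    ext r
    simp only [Finset.sum_apply, ← Matrix.mulVec_mulVec, ← Matrix.mulVec_add, ← hcast]
    simp [Matrix.mulVec, dotProduct, Fintype.sum_prod_type, hA]
  · refine l2norm_le_of_sum_sq_le (by positivity) ?_
    have hblock : ∀ i, ∑ j, (xhat (i, j) : ℝ) ^ 2 ≤
        2 * (1 + m * B ^ 2) * ∑ j, ((x1 i j : ℝ) ^ 2 + (x2 i j : ℝ) ^ 2) := by
      intro i
      have hR := sum_sq_mulVec_le (R i) (hcols i) (x2 i)
      rw [Fintype.card_fin] at hR
      have hadd : ∑ j, (xhat (i, j) : ℝ) ^ 2 ≤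
          2 * (∑ j, (x1 i j : ℝ) ^ 2 + ∑ j, ((R i).mulVec (x2 i) j : ℝ) ^ 2) := by
        rw [← Finset.sum_add_distrib, Finset.mul_sum]
        refine Finset.sum_le_sum fun j _ => ?_
        rw [hxhat, Pi.add_apply, Int.cast_add]
        exact add_sq_le
      have h1 : 0 ≤ ∑ j, (x1 i j : ℝ) ^ 2 := by positivity
      have h2 : 0 ≤ ∑ j, (x2 i j : ℝ) ^ 2 := by positivity
      have hmB : 0 ≤ (m : ℝ) * B ^ 2 := by positivity
      rw [Finset.sum_add_distrib]
      nlinarith [mul_nonneg hmB h1]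
    have hxs : ∑ i, ∑ j, ((x1 i j : ℝ) ^ 2 + (x2 i j : ℝ) ^ 2) ≤ s ^ 2 := by
      have h := sum_sq_le_of_l2norm_le hnorm
      simpa [Fintype.sum_prod_type, hx, Finset.sum_add_distrib] using h
    have hsm : Real.sqrt m ^ 2 = m := Real.sq_sqrt (Nat.cast_nonneg m)
    have hBm : 1 + m * B ^ 2 ≤ (1 + B * Real.sqrt m) ^ 2 := by
      have : 0 ≤ B * Real.sqrt m := by positivity
      nlinarith
    calc ∑ p, (xhat p : ℝ) ^ 2
        ≤ 2 * (1 + m * B ^ 2) * ∑ i, ∑ j, ((x1 i j : ℝ) ^ 2 + (x2 i j : ℝ) ^ 2) := by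
          rw [Fintype.sum_prod_type, Finset.mul_sum]
          exact Finset.sum_le_sum fun i _ => hblock i
      _ ≤ 2 * (1 + B * Real.sqrt m) ^ 2 * s ^ 2 := by gcongr
      _ = (Real.sqrt 2 * (1 + B * Real.sqrt m) * s) ^ 2 := by
          rw [mul_pow, mul_pow, Real.sq_sqrt zero_le_two]
end
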